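/- arXiv:1411.0476 — 5 statements merged into one kernel-verified Lean document; each statement's English description precedes it below -/
import Mathlib

section
/- (Bäcklund transformation for the semi-discrete Ito system.) Let h > 0, λ, ω, μ ∈ ℝ with λ ≠ 0, and let f, g : ℝ³ → ℝ be smooth functions of (n, x, t) with f nowhere zero. Suppose f satisfies (D_t² + D_x³D_t) f·f = 0, (D_xD_t − (2/h)D_t) f_n·f_{n−h} = 0 and (hD_t + hD_x³ + (12/h)D_x − 6D_x²) f_n·f_{n−h} = 0 at every point, and suppose g satisfies at every point: (i) (D_x e^{−(h/2)D_n} + λ D_x e^{(h/2)D_n} − (2/h)λ e^{(h/2)D_n} + (2/h) e^{−(h/2)D_n}) f·g = 0; (ii) (D_t e^{−(h/2)D_n} − λ D_t e^{(h/2)D_n} − λω e^{(h/2)D_n} + ω e^{−(h/2)D_n}) f·g = 0; (iii) (D_t + D_x³) f·g = 0; (iv) (D_xD_t − μ D_x) f·g = 0. Then g satisfies (D_t² + D_x³D_t) g·g = 0, (D_xD_t − (2/h)D_t) g_n·g_{n−h} = 0 and (hD_t + hD_x³ + (12/h)D_x − 6D_x²) g_n·g_{n−h} = 0 at every point. -/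
/-- Hirota bilinear operator `D_x^a D_t^c e^{δ D_n}` applied to a pair of functions
of `(n, x, t)`, evaluated at `(n, x, t)`. -/
noncomputable def hirota3 (a c : ℕ) (δ : ℝ) (A B : ℝ → ℝ → ℝ → ℝ) (n x t : ℝ) : ℝ :=
  iteratedDeriv a (fun r =>
    iteratedDeriv c (fun w => A (n + δ) (x + r) (t + w) * B (n - δ) (x - r) (t - w)) 0) 0

/-- Joint smoothness of a function of `(n, x, t)`. -/
def Smooth3 (A : ℝ → ℝ → ℝ → ℝ) : Prop :=
  ContDiff ℝ (⊤ : ℕ∞) (fun p : ℝ × ℝ × ℝ => A p.1 p.2.1 p.2.2)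

/-- Partial derivative in the second variable. -/
noncomputable def dx (A : ℝ → ℝ → ℝ → ℝ) (n x t : ℝ) : ℝ := deriv (fun s => A n s t) x

/-- Partial derivative in the third variable. -/
noncomputable def dt (A : ℝ → ℝ → ℝ → ℝ) (n x t : ℝ) : ℝ := deriv (fun s => A n x s) t

lemma HasFDerivAt.hasDerivAt_line_x {E : Type*} [NormedAddCommGroup E] [NormedSpace ℝ E]
    {G : ℝ × ℝ × ℝ → E} {G' : ℝ × ℝ × ℝ →L[ℝ] E} {n x t : ℝ} (hG : HasFDerivAt G G' (n, x, t)) :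
    HasDerivAt (fun s => G (n, s, t)) (G' (0, 1, 0)) x :=
  hG.comp_hasDerivAt (f := fun s : ℝ => (n, s, t)) x
    ((hasDerivAt_const x n).prodMk ((hasDerivAt_id' x).prodMk (hasDerivAt_const x t)))

lemma HasFDerivAt.hasDerivAt_line_t {E : Type*} [NormedAddCommGroup E] [NormedSpace ℝ E]
    {G : ℝ × ℝ × ℝ → E} {G' : ℝ × ℝ × ℝ →L[ℝ] E} {n x t : ℝ} (hG : HasFDerivAt G G' (n, x, t)) :
    HasDerivAt (fun s => G (n, x, s)) (G' (0, 0, 1)) t :=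
  hG.comp_hasDerivAt (f := fun s : ℝ => (n, x, s)) t
    ((hasDerivAt_const t n).prodMk ((hasDerivAt_const t x).prodMk (hasDerivAt_id' t)))

namespace Smooth3

variable {A B : ℝ → ℝ → ℝ → ℝ}

lemma hasFDerivAt (hA : Smooth3 A) (p : ℝ × ℝ × ℝ) :
    HasFDerivAt (fun p : ℝ × ℝ × ℝ => A p.1 p.2.1 p.2.2)
      (fderiv ℝ (fun p : ℝ × ℝ × ℝ => A p.1 p.2.1 p.2.2) p) p :=
  (hA.differentiable (by simp) p).hasFDerivAt

lemma hasDerivAt_x_fderiv (hA : Smooth3 A) (n x t : ℝ) :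
    HasDerivAt (fun s => A n s t)
      (fderiv ℝ (fun p : ℝ × ℝ × ℝ => A p.1 p.2.1 p.2.2) (n, x, t) (0, 1, 0)) x :=
  (hA.hasFDerivAt (n, x, t)).hasDerivAt_line_x

lemma hasDerivAt_t_fderiv (hA : Smooth3 A) (n x t : ℝ) :
    HasDerivAt (fun s => A n x s)
      (fderiv ℝ (fun p : ℝ × ℝ × ℝ => A p.1 p.2.1 p.2.2) (n, x, t) (0, 0, 1)) t :=
  (hA.hasFDerivAt (n, x, t)).hasDerivAt_line_t

lemma dx_eq (hA : Smooth3 A) (n x t : ℝ) :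
    dx A n x t = fderiv ℝ (fun p : ℝ × ℝ × ℝ => A p.1 p.2.1 p.2.2) (n, x, t) (0, 1, 0) :=
  (hA.hasDerivAt_x_fderiv n x t).deriv

lemma dt_eq (hA : Smooth3 A) (n x t : ℝ) :
    dt A n x t = fderiv ℝ (fun p : ℝ × ℝ × ℝ => A p.1 p.2.1 p.2.2) (n, x, t) (0, 0, 1) :=
  (hA.hasDerivAt_t_fderiv n x t).deriv

lemma hasDerivAt_x (hA : Smooth3 A) (n x t : ℝ) :
    HasDerivAt (fun s => A n s t) (dx A n x t) x :=
  (hA.hasDerivAt_x_fderiv n x t).differentiableAt.hasDerivAt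

lemma hasDerivAt_t (hA : Smooth3 A) (n x t : ℝ) :
    HasDerivAt (fun s => A n x s) (dt A n x t) t :=
  (hA.hasDerivAt_t_fderiv n x t).differentiableAt.hasDerivAt

lemma contDiff_fderiv (hA : Smooth3 A) :
    ContDiff ℝ (⊤ : ℕ∞) (fderiv ℝ (fun p : ℝ × ℝ × ℝ => A p.1 p.2.1 p.2.2)) :=
  ContDiff.fderiv_right hA (by simp)

protected lemma dx (hA : Smooth3 A) : Smooth3 (dx A) := by
  unfold Smooth3
  simp only [hA.dx_eq]
  exact hA.contDiff_fderiv.clm_apply contDiff_const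

protected lemma dt (hA : Smooth3 A) : Smooth3 (dt A) := by
  unfold Smooth3
  simp only [hA.dt_eq]
  exact hA.contDiff_fderiv.clm_apply contDiff_const

/-- Mixed partial derivatives of a smooth function agree. -/
lemma dt_dx (hA : Smooth3 A) : _root_.dt (_root_.dx A) = _root_.dx (_root_.dt A) := by
  funext n x t
  have hd := (hA.contDiff_fderiv.differentiable (by simp) (n, x, t)).hasFDerivAt
  have h1 := hd.hasDerivAt_line_t.clm_apply (hasDerivAt_const t ((0, 1, 0) : ℝ × ℝ × ℝ))
  have h2 := hd.hasDerivAt_line_x.clm_apply (hasDerivAt_const x ((0, 0, 1) : ℝ × ℝ × ℝ))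
  have hsymm : IsSymmSndFDerivAt ℝ (fun p : ℝ × ℝ × ℝ => A p.1 p.2.1 p.2.2) (n, x, t) :=
    (ContDiff.contDiffAt hA).isSymmSndFDerivAt (by
      rw [minSmoothness_of_isRCLikeNormedField]
      exact WithTop.coe_le_coe.2 (le_top : (2 : ℕ∞) ≤ ⊤))
  have e1 : (fun s => _root_.dx A n x s) = _ := funext fun s => hA.dx_eq n x s
  have e2 : (fun s => _root_.dt A n s t) = _ := funext fun s => hA.dt_eq n s t
  rw [_root_.dt, _root_.dx, e1, e2]
  refine h1.deriv.trans (Eq.trans ?_ h2.deriv.symm)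
  simpa using hsymm.eq (0, 0, 1) (0, 1, 0)

/-- Translation in the first variable preserves smoothness. -/
lemma shift (hA : Smooth3 A) (h : ℝ) : Smooth3 (fun n x t => A (n - h) x t) :=
  ContDiff.comp (g := fun p : ℝ × ℝ × ℝ => A p.1 p.2.1 p.2.2) hA
    (f := fun p : ℝ × ℝ × ℝ => (p.1 - h, p.2.1, p.2.2)) (by fun_prop)

lemma contDiff_slice (hA : Smooth3 A) {u v w : ℝ → ℝ} (hu : ContDiff ℝ (⊤ : ℕ∞) u)
    (hv : ContDiff ℝ (⊤ : ℕ∞) v) (hw : ContDiff ℝ (⊤ : ℕ∞) w) :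
    ContDiff ℝ (⊤ : ℕ∞) (fun s => A (u s) (v s) (w s)) :=
  ContDiff.comp (g := fun p : ℝ × ℝ × ℝ => A p.1 p.2.1 p.2.2) hA
    (f := fun s : ℝ => (u s, v s, w s)) (hu.prodMk (hv.prodMk hw))

lemma contDiff_w (hA : Smooth3 A) (hB : Smooth3 B) (n m x y t : ℝ) :
    ContDiff ℝ (⊤ : ℕ∞) (fun w => A n x (t + w) * B m y (t - w)) :=
  (hA.contDiff_slice (by fun_prop) (by fun_prop) (by fun_prop)).mul
    (hB.contDiff_slice (by fun_prop) (by fun_prop) (by fun_prop))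

lemma contDiff_r (hA : Smooth3 A) (hB : Smooth3 B) (n m x t s : ℝ) :
    ContDiff ℝ (⊤ : ℕ∞) (fun r => A n (x + r) t * B m (x - r) s) :=
  (hA.contDiff_slice (by fun_prop) (by fun_prop) (by fun_prop)).mul
    (hB.contDiff_slice (by fun_prop) (by fun_prop) (by fun_prop))

lemma iteratedDeriv_w_succ (hA : Smooth3 A) (hB : Smooth3 B) (c : ℕ) (n m x y t : ℝ) :
    iteratedDeriv (c + 1) (fun w => A n x (t + w) * B m y (t - w)) 0 =
      iteratedDeriv c (fun w => _root_.dt A n x (t + w) * B m y (t - w)) 0 -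
        iteratedDeriv c (fun w => A n x (t + w) * _root_.dt B m y (t - w)) 0 := by
  have hd : deriv (fun w => A n x (t + w) * B m y (t - w)) =
      (fun w => _root_.dt A n x (t + w) * B m y (t - w)) -
        (fun w => A n x (t + w) * _root_.dt B m y (t - w)) := by
    funext w
    have h1 := (hA.hasDerivAt_t n x (t + w)).comp_const_add t w
    have h2 := (hB.hasDerivAt_t m y (t - w)).comp_const_sub t w
    rw [(h1.fun_mul h2).deriv]
    simp [sub_eq_add_neg]
  rw [iteratedDeriv_succ', hd, iteratedDeriv_sub]
  · exact ((hA.dt.contDiff_w hB n m x y t).of_le (by exact_mod_cast le_top)).contDiffAt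
  · exact ((hA.contDiff_w hB.dt n m x y t).of_le (by exact_mod_cast le_top)).contDiffAt

lemma contDiff_iteratedDeriv_w (c : ℕ) (n m x t : ℝ) :
    ∀ {A B : ℝ → ℝ → ℝ → ℝ}, Smooth3 A → Smooth3 B →
      ContDiff ℝ (⊤ : ℕ∞) (fun r =>
        iteratedDeriv c (fun w => A n (x + r) (t + w) * B m (x - r) (t - w)) 0) := by
  induction c with
  | zero =>
    intro A B hA hB
    simpa using hA.contDiff_r hB n m x t t
  | succ c ih =>
    intro A B hA hB
    simp only [hA.iteratedDeriv_w_succ hB]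
    exact (ih hA.dt hB).sub (ih hA hB.dt)

lemma hirota3_zero (A B : ℝ → ℝ → ℝ → ℝ) (δ n x t : ℝ) :
    hirota3 0 0 δ A B n x t = A (n + δ) x t * B (n - δ) x t := by
  simp [hirota3]

lemma hirota3_succ_t (hA : Smooth3 A) (hB : Smooth3 B) (a c : ℕ) (δ n x t : ℝ) :
    hirota3 a (c + 1) δ A B n x t =
      hirota3 a c δ (_root_.dt A) B n x t - hirota3 a c δ A (_root_.dt B) n x t := by
  simp only [hirota3, hA.iteratedDeriv_w_succ hB]
  rw [iteratedDeriv_fun_sub]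
  · exact ((contDiff_iteratedDeriv_w c _ _ x t hA.dt hB).of_le
      (by exact_mod_cast le_top)).contDiffAt
  · exact ((contDiff_iteratedDeriv_w c _ _ x t hA hB.dt).of_le
      (by exact_mod_cast le_top)).contDiffAt

lemma hirota3_succ_x (hA : Smooth3 A) (hB : Smooth3 B) (a : ℕ) (δ n x t : ℝ) :
    hirota3 (a + 1) 0 δ A B n x t =
      hirota3 a 0 δ (_root_.dx A) B n x t - hirota3 a 0 δ A (_root_.dx B) n x t := by
  simp only [hirota3, iteratedDeriv_zero, add_zero, sub_zero]
  have hd : deriv (fun r => A (n + δ) (x + r) t * B (n - δ) (x - r) t) =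
      (fun r => _root_.dx A (n + δ) (x + r) t * B (n - δ) (x - r) t) -
        (fun r => A (n + δ) (x + r) t * _root_.dx B (n - δ) (x - r) t) := by
    funext r
    have h1 := (hA.hasDerivAt_x (n + δ) (x + r) t).comp_const_add x r
    have h2 := (hB.hasDerivAt_x (n - δ) (x - r) t).comp_const_sub x r
    rw [(h1.fun_mul h2).deriv]
    simp [sub_eq_add_neg]
  rw [iteratedDeriv_succ', hd, iteratedDeriv_sub]
  · exact ((hA.dx.contDiff_r hB _ _ x t t).of_le (by exact_mod_cast le_top)).contDiffAt
  · exact ((hA.contDiff_r hB.dx _ _ x t t).of_le (by exact_mod_cast le_top)).contDiffAt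

lemma hasDerivAt_hirota3_x (δ n x t : ℝ) (a c : ℕ) :
    ∀ {A B : ℝ → ℝ → ℝ → ℝ}, Smooth3 A → Smooth3 B →
      HasDerivAt (fun s => hirota3 a c δ A B n s t)
        (hirota3 a c δ (_root_.dx A) B n x t + hirota3 a c δ A (_root_.dx B) n x t) x := by
  induction c with
  | zero =>
    induction a with
    | zero =>
      intro A B hA hB
      simp only [hirota3_zero]
      exact (hA.hasDerivAt_x (n + δ) x t).mul (hB.hasDerivAt_x (n - δ) x t)
    | succ a ih =>
      intro A B hA hB
      simp only [hA.hirota3_succ_x hB, hA.dx.hirota3_succ_x hB, hA.hirota3_succ_x hB.dx]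
      exact ((ih hA.dx hB).sub (ih hA hB.dx)).congr_deriv (by ring)
  | succ c ih =>
    intro A B hA hB
    simp only [hA.hirota3_succ_t hB, hA.dx.hirota3_succ_t hB, hA.hirota3_succ_t hB.dx,
      hA.dt_dx, hB.dt_dx]
    exact ((ih hA.dt hB).sub (ih hA hB.dt)).congr_deriv (by ring)

lemma hasDerivAt_hirota3_t (δ n x t : ℝ) (a c : ℕ) :
    ∀ {A B : ℝ → ℝ → ℝ → ℝ}, Smooth3 A → Smooth3 B →
      HasDerivAt (fun s => hirota3 a c δ A B n x s)
        (hirota3 a c δ (_root_.dt A) B n x t + hirota3 a c δ A (_root_.dt B) n x t) t := by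
  induction c with
  | zero =>
    induction a with
    | zero =>
      intro A B hA hB
      simp only [hirota3_zero]
      exact (hA.hasDerivAt_t (n + δ) x t).mul (hB.hasDerivAt_t (n - δ) x t)
    | succ a ih =>
      intro A B hA hB
      simp only [hA.hirota3_succ_x hB, hA.dt.hirota3_succ_x hB, hA.hirota3_succ_x hB.dt,
        ← hA.dt_dx, ← hB.dt_dx]
      exact ((ih hA.dx hB).sub (ih hA hB.dx)).congr_deriv (by ring)
  | succ c ih =>
    intro A B hA hB
    simp only [hA.hirota3_succ_t hB, hA.dt.hirota3_succ_t hB, hA.hirota3_succ_t hB.dt]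
    exact ((ih hA.dt hB).sub (ih hA hB.dt)).congr_deriv (by ring)

end Smooth3

section Expansions

variable {A B : ℝ → ℝ → ℝ → ℝ}

lemma hirota3_one_zero (hA : Smooth3 A) (hB : Smooth3 B) (δ n x t : ℝ) :
    hirota3 1 0 δ A B n x t =
      dx A (n + δ) x t * B (n - δ) x t - A (n + δ) x t * dx B (n - δ) x t := by
  simp only [hA.hirota3_succ_x hB, Smooth3.hirota3_zero]

lemma hirota3_zero_one (hA : Smooth3 A) (hB : Smooth3 B) (δ n x t : ℝ) :
    hirota3 0 1 δ A B n x t =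
      dt A (n + δ) x t * B (n - δ) x t - A (n + δ) x t * dt B (n - δ) x t := by
  simp only [hA.hirota3_succ_t hB, Smooth3.hirota3_zero]

lemma hirota3_two_zero (hA : Smooth3 A) (hB : Smooth3 B) (δ n x t : ℝ) :
    hirota3 2 0 δ A B n x t =
      dx (dx A) (n + δ) x t * B (n - δ) x t - 2 * (dx A (n + δ) x t * dx B (n - δ) x t)
        + A (n + δ) x t * dx (dx B) (n - δ) x t := by
  rw [hA.hirota3_succ_x hB, hirota3_one_zero hA.dx hB, hirota3_one_zero hA hB.dx]
  ring

lemma hirota3_zero_two (hA : Smooth3 A) (hB : Smooth3 B) (δ n x t : ℝ) :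
    hirota3 0 2 δ A B n x t =
      dt (dt A) (n + δ) x t * B (n - δ) x t - 2 * (dt A (n + δ) x t * dt B (n - δ) x t)
        + A (n + δ) x t * dt (dt B) (n - δ) x t := by
  rw [hA.hirota3_succ_t hB, hirota3_zero_one hA.dt hB, hirota3_zero_one hA hB.dt]
  ring

lemma hirota3_one_one (hA : Smooth3 A) (hB : Smooth3 B) (δ n x t : ℝ) :
    hirota3 1 1 δ A B n x t =
      dx (dt A) (n + δ) x t * B (n - δ) x t - dt A (n + δ) x t * dx B (n - δ) x t
        - dx A (n + δ) x t * dt B (n - δ) x t + A (n + δ) x t * dx (dt B) (n - δ) x t := by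
  rw [hA.hirota3_succ_t hB, hirota3_one_zero hA.dt hB, hirota3_one_zero hA hB.dt]
  ring

lemma hirota3_three_zero (hA : Smooth3 A) (hB : Smooth3 B) (δ n x t : ℝ) :
    hirota3 3 0 δ A B n x t =
      dx (dx (dx A)) (n + δ) x t * B (n - δ) x t
        - 3 * (dx (dx A) (n + δ) x t * dx B (n - δ) x t)
        + 3 * (dx A (n + δ) x t * dx (dx B) (n - δ) x t)
        - A (n + δ) x t * dx (dx (dx B)) (n - δ) x t := by
  rw [hA.hirota3_succ_x hB, hirota3_two_zero hA.dx hB, hirota3_two_zero hA hB.dx]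
  ring

lemma hirota3_three_one (hA : Smooth3 A) (hB : Smooth3 B) (δ n x t : ℝ) :
    hirota3 3 1 δ A B n x t =
      hirota3 3 0 δ (dt A) B n x t - hirota3 3 0 δ A (dt B) n x t :=
  hA.hirota3_succ_t hB 3 0 δ n x t

end Expansions

/-- The derivative of a function that vanishes identically is zero. -/
lemma HasDerivAt.eq_zero_of_forall_eq_zero {F : ℝ → ℝ} {F' s : ℝ} (hF : HasDerivAt F F' s)
    (h0 : ∀ r, F r = 0) : F' = 0 := by
  rw [← hF.deriv, funext h0, deriv_const]

/-- Proposition 5: Bäcklund transformation for the semi-discrete Ito system. -/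
theorem semidiscrete_Ito_Backlund
    (h : ℝ) (hh : 0 < h) (lam ω μ : ℝ) (hlam : lam ≠ 0) (f g : ℝ → ℝ → ℝ → ℝ)
    (hf : ContDiff ℝ (⊤ : ℕ∞) (fun pt : ℝ × ℝ × ℝ => f pt.1 pt.2.1 pt.2.2))
    (hg : ContDiff ℝ (⊤ : ℕ∞) (fun pt : ℝ × ℝ × ℝ => g pt.1 pt.2.1 pt.2.2))
    (hfne : ∀ n x t, f n x t ≠ 0)
    (hfeq1 : ∀ n x t,
      hirota3 0 2 0 f f n x t + hirota3 3 1 0 f f n x t = 0)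
    (hfeq2 : ∀ n x t,
      hirota3 1 1 0 f (fun n' x' t' => f (n' - h) x' t') n x t
        - (2/h) * hirota3 0 1 0 f (fun n' x' t' => f (n' - h) x' t') n x t = 0)
    (hfeq3 : ∀ n x t,
      h * hirota3 0 1 0 f (fun n' x' t' => f (n' - h) x' t') n x t
        + h * hirota3 3 0 0 f (fun n' x' t' => f (n' - h) x' t') n x t
        + (12/h) * hirota3 1 0 0 f (fun n' x' t' => f (n' - h) x' t') n x t
        - 6 * hirota3 2 0 0 f (fun n' x' t' => f (n' - h) x' t') n x t = 0)
    (hbt1 : ∀ n x t,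
      hirota3 1 0 (-(h/2)) f g n x t + lam * hirota3 1 0 (h/2) f g n x t
        - (2/h) * lam * hirota3 0 0 (h/2) f g n x t
        + (2/h) * hirota3 0 0 (-(h/2)) f g n x t = 0)
    (hbt2 : ∀ n x t,
      hirota3 0 1 (-(h/2)) f g n x t - lam * hirota3 0 1 (h/2) f g n x t
        - lam * ω * hirota3 0 0 (h/2) f g n x t
        + ω * hirota3 0 0 (-(h/2)) f g n x t = 0)
    (hbt3 : ∀ n x t,
      hirota3 0 1 0 f g n x t + hirota3 3 0 0 f g n x t = 0)
    (hbt4 : ∀ n x t,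
      hirota3 1 1 0 f g n x t - μ * hirota3 1 0 0 f g n x t = 0) :
    (∀ n x t,
      hirota3 0 2 0 g g n x t + hirota3 3 1 0 g g n x t = 0) ∧
    (∀ n x t,
      hirota3 1 1 0 g (fun n' x' t' => g (n' - h) x' t') n x t
        - (2/h) * hirota3 0 1 0 g (fun n' x' t' => g (n' - h) x' t') n x t = 0) ∧
    (∀ n x t,
      h * hirota3 0 1 0 g (fun n' x' t' => g (n' - h) x' t') n x t
        + h * hirota3 3 0 0 g (fun n' x' t' => g (n' - h) x' t') n x t
        + (12/h) * hirota3 1 0 0 g (fun n' x' t' => g (n' - h) x' t') n x t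
        - 6 * hirota3 2 0 0 g (fun n' x' t' => g (n' - h) x' t') n x t = 0) := by
  have sf : Smooth3 f := hf
  have sg : Smooth3 g := hg
  have sf' := sf.shift h
  have sg' := sg.shift h
  have hh0 : h ≠ 0 := hh.ne'
  have hsub : ∀ n : ℝ, n - h / 2 + -(h / 2) = n - h := fun n => by ring
  have hself : ∀ n : ℝ, n - h / 2 - -(h / 2) = n := fun n => by ring
  have hsub' : ∀ n : ℝ, n - h / 2 - h / 2 = n - h := fun n => by ring
  have dx_shift : ∀ (A : ℝ → ℝ → ℝ → ℝ), dx (fun n x t => A (n - h) x t) =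
    fun n x t => dx A (n - h) x t := fun _ => rfl
  have dt_shift : ∀ (A : ℝ → ℝ → ℝ → ℝ), dt (fun n x t => A (n - h) x t) =
    fun n x t => dt A (n - h) x t := fun _ => rfl
  refine ⟨fun n x t => ?_, fun n x t => ?_, fun n x t => ?_⟩
  · have h3t := ((Smooth3.hasDerivAt_hirota3_t 0 n x t 0 1 sf sg).add
      (Smooth3.hasDerivAt_hirota3_t 0 n x t 3 0 sf sg)).eq_zero_of_forall_eq_zero
      fun s => hbt3 n x s
    have h4x := ((Smooth3.hasDerivAt_hirota3_x 0 n x t 1 1 sf sg).sub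
      ((Smooth3.hasDerivAt_hirota3_x 0 n x t 1 0 sf sg).const_mul μ)).eq_zero_of_forall_eq_zero
      fun s => hbt4 n s t
    have h1 := hfeq1 n x t
    have h3 := hbt3 n x t
    have h4 := hbt4 n x t
    simp only [hirota3_one_zero, hirota3_zero_one, hirota3_zero_two, hirota3_one_one,
      hirota3_three_zero, hirota3_three_one, Smooth3.dt_dx, sf, sg, Smooth3.dx, Smooth3.dt,
      add_zero, sub_zero] at h1 h3 h4 h3t h4x ⊢
    refine mul_left_cancel₀ (pow_ne_zero 2 (hfne n x t)) ?_
    linear_combination (g n x t) ^ 2 * h1 - 2 * (f n x t * g n x t) * h3t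
      + 2 * (dt f n x t * g n x t + f n x t * dt g n x t) * h3
      + 6 * (dx f n x t * g n x t - f n x t * dx g n x t) * h4x
      - 6 * (dx (dx f) n x t * g n x t - f n x t * dx (dx g) n x t) * h4
  · have h1t := ((((Smooth3.hasDerivAt_hirota3_t (-(h / 2)) (n - h / 2) x t 1 0 sf sg).add
      ((Smooth3.hasDerivAt_hirota3_t (h / 2) (n - h / 2) x t 1 0 sf sg).const_mul lam)).sub
      ((Smooth3.hasDerivAt_hirota3_t (h / 2) (n - h / 2) x t 0 0 sf sg).const_mul
        (2 / h * lam))).add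
      ((Smooth3.hasDerivAt_hirota3_t (-(h / 2)) (n - h / 2) x t 0 0 sf sg).const_mul
        (2 / h))).eq_zero_of_forall_eq_zero fun s => hbt1 (n - h / 2) x s
    have h2x := ((((Smooth3.hasDerivAt_hirota3_x (-(h / 2)) (n - h / 2) x t 0 1 sf sg).sub
      ((Smooth3.hasDerivAt_hirota3_x (h / 2) (n - h / 2) x t 0 1 sf sg).const_mul lam)).sub
      ((Smooth3.hasDerivAt_hirota3_x (h / 2) (n - h / 2) x t 0 0 sf sg).const_mul
        (lam * ω))).add
      ((Smooth3.hasDerivAt_hirota3_x (-(h / 2)) (n - h / 2) x t 0 0 sf sg).const_mul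
        ω)).eq_zero_of_forall_eq_zero fun s => hbt2 (n - h / 2) s t
    have h0 := hfeq2 n x t
    have h1 := hbt1 (n - h / 2) x t
    have h2 := hbt2 (n - h / 2) x t
    simp only [hirota3_one_zero, hirota3_zero_one, hirota3_one_one, Smooth3.hirota3_zero,
      Smooth3.dt_dx, sf, sg, sf', sg', Smooth3.dx, Smooth3.dt, dx_shift, dt_shift,
      add_zero, sub_zero, hsub, hsub', hself, sub_add_cancel] at h0 h1 h2 h1t h2x ⊢
    refine mul_left_cancel₀ (mul_ne_zero hlam (mul_ne_zero (hfne n x t) (hfne (n - h) x t))) ?_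
    linear_combination lam * g n x t * g (n - h) x t * h0
      - (f (n - h) x t * g n x t + lam * (f n x t * g (n - h) x t)) / 2 * h1t
      + (f (n - h) x t * g n x t - lam * (f n x t * g (n - h) x t)) / 2 * h2x
      + (dt f (n - h) x t * g n x t + f (n - h) x t * dt g n x t
        + lam * (dt f n x t * g (n - h) x t + f n x t * dt g (n - h) x t)) / 2 * h1
      - (dx f (n - h) x t * g n x t + f (n - h) x t * dx g n x t
        - lam * (dx f n x t * g (n - h) x t + f n x t * dx g (n - h) x t)) / 2 * h2
  · have h1x := ((((Smooth3.hasDerivAt_hirota3_x (-(h / 2)) (n - h / 2) x t 1 0 sf sg).add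
      ((Smooth3.hasDerivAt_hirota3_x (h / 2) (n - h / 2) x t 1 0 sf sg).const_mul lam)).sub
      ((Smooth3.hasDerivAt_hirota3_x (h / 2) (n - h / 2) x t 0 0 sf sg).const_mul
        (2 / h * lam))).add
      ((Smooth3.hasDerivAt_hirota3_x (-(h / 2)) (n - h / 2) x t 0 0 sf sg).const_mul
        (2 / h))).eq_zero_of_forall_eq_zero fun s => hbt1 (n - h / 2) s t
    have h0 := hfeq3 n x t
    have h1 := hbt1 (n - h / 2) x t
    have h3 := hbt3 n x t
    have h3' := hbt3 (n - h) x t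
    simp only [hirota3_one_zero, hirota3_zero_one, hirota3_two_zero, hirota3_three_zero,
      Smooth3.hirota3_zero, sf, sg, sf', sg', Smooth3.dx, dx_shift, dt_shift,
      add_zero, sub_zero, hsub, hsub', hself, sub_add_cancel] at h0 h1 h3 h3' h1x ⊢
    refine mul_left_cancel₀ (mul_ne_zero (hfne n x t) (hfne (n - h) x t)) ?_
    linear_combination (norm := skip) g n x t * g (n - h) x t * h0
      - h * (f (n - h) x t * g (n - h) x t) * h3 + h * (f n x t * g n x t) * h3'
      - 3 * h * (dx f n x t * g (n - h) x t - f n x t * dx g (n - h) x t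
        - 2 / h * (f n x t * g (n - h) x t)) * h1x
      + 3 * h * (dx (dx f) n x t * g (n - h) x t - f n x t * dx (dx g) (n - h) x t
        - 2 / h * (dx f n x t * g (n - h) x t + f n x t * dx g (n - h) x t)) * h1
    field_simp
    ring
end

section
/- (Bilinear identity A.2.) For all smooth functions f, g : ℝ² → ℝ of (n, x), every real h, and every point (n, x): (D_x² e^{(h/2)D_n} f·f)(e^{(h/2)D_n} g·g) − (e^{(h/2)D_n} f·f)(D_x² e^{(h/2)D_n} g·g) = D_x[(D_x e^{(h/2)D_n} f·g)·(e^{−(h/2)D_n} f·g)] − D_x[(e^{(h/2)D_n} f·g)·(D_x e^{−(h/2)D_n} f·g)]. -/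
/-- Hirota bilinear operator `D_x^a e^{δ D_n}` applied to a pair of functions
of `(n, x)`, evaluated at `(n, x)`. -/
noncomputable def hirota2 (a : ℕ) (δ : ℝ) (A B : ℝ → ℝ → ℝ) (n x : ℝ) : ℝ :=
  iteratedDeriv a (fun r => A (n + δ) (x + r) * B (n - δ) (x - r)) 0

theorem hasDerivAt_mul_reflect {u v : ℝ → ℝ} (hu : Differentiable ℝ u) (hv : Differentiable ℝ v)
    (x r : ℝ) :
    HasDerivAt (fun r => u (x + r) * v (x - r))
      (deriv u (x + r) * v (x - r) - u (x + r) * deriv v (x - r)) r := by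
  have h₁ : HasDerivAt (fun r => u (x + r)) (deriv u (x + r)) r :=
    (hu (x + r)).hasDerivAt.comp_const_add x r
  have h₂ : HasDerivAt (fun r => v (x - r)) (-deriv v (x - r)) r :=
    (hv (x - r)).hasDerivAt.comp_const_sub x r
  exact (h₁.mul h₂).congr_deriv (by ring)

theorem hirota2_zero (δ : ℝ) (A B : ℝ → ℝ → ℝ) (n x : ℝ) :
    hirota2 0 δ A B n x = A (n + δ) x * B (n - δ) x := by
  simp [hirota2]

theorem hirota2_one {δ : ℝ} {A B : ℝ → ℝ → ℝ} {n : ℝ} (hA : Differentiable ℝ (A (n + δ)))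
    (hB : Differentiable ℝ (B (n - δ))) (x : ℝ) :
    hirota2 1 δ A B n x =
      deriv (A (n + δ)) x * B (n - δ) x - A (n + δ) x * deriv (B (n - δ)) x := by
  simpa [hirota2] using (hasDerivAt_mul_reflect hA hB x 0).deriv

theorem hirota2_two {δ : ℝ} {A B : ℝ → ℝ → ℝ} {n : ℝ} (hA : Differentiable ℝ (A (n + δ)))
    (hB : Differentiable ℝ (B (n - δ))) (hA' : Differentiable ℝ (deriv (A (n + δ))))
    (hB' : Differentiable ℝ (deriv (B (n - δ)))) (x : ℝ) :
    hirota2 2 δ A B n x =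
      deriv (deriv (A (n + δ))) x * B (n - δ) x
        - 2 * (deriv (A (n + δ)) x * deriv (B (n - δ)) x)
        + A (n + δ) x * deriv (deriv (B (n - δ))) x := by
  have h₁ : deriv (fun r => A (n + δ) (x + r) * B (n - δ) (x - r)) = fun r =>
      deriv (A (n + δ)) (x + r) * B (n - δ) (x - r)
        - A (n + δ) (x + r) * deriv (B (n - δ)) (x - r) :=
    funext fun r => (hasDerivAt_mul_reflect hA hB x r).deriv
  have h₂ := ((hasDerivAt_mul_reflect hA' hB x 0).sub (hasDerivAt_mul_reflect hA hB' x 0)).deriv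
  rw [hirota2, iteratedDeriv_succ, iteratedDeriv_one, h₁]
  refine h₂.trans ?_
  simp only [add_zero, sub_zero]
  ring

/-- Bilinear identity (A.2). -/
theorem bilinear_identity_A2
    (f g : ℝ → ℝ → ℝ)
    (hf : ContDiff ℝ (⊤ : ℕ∞) (fun pt : ℝ × ℝ => f pt.1 pt.2))
    (hg : ContDiff ℝ (⊤ : ℕ∞) (fun pt : ℝ × ℝ => g pt.1 pt.2))
    (h n x : ℝ) :
    hirota2 2 (h/2) f f n x * hirota2 0 (h/2) g g n x
        - hirota2 0 (h/2) f f n x * hirota2 2 (h/2) g g n x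
      = hirota2 1 0 (hirota2 1 (h/2) f g) (hirota2 0 (-(h/2)) f g) n x
        - hirota2 1 0 (hirota2 0 (h/2) f g) (hirota2 1 (-(h/2)) f g) n x := by
  have slice : ∀ u : ℝ → ℝ → ℝ, ContDiff ℝ (⊤ : ℕ∞) (fun pt : ℝ × ℝ => u pt.1 pt.2) →
      ∀ m, Differentiable ℝ (u m) ∧ Differentiable ℝ (deriv (u m)) := by
    intro u hu m
    have hm : ContDiff ℝ (⊤ : ℕ∞) (u m) := hu.comp (contDiff_const.prodMk contDiff_id)
    exact ⟨hm.differentiable (by simp),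
      (contDiff_infty_iff_deriv.mp hm).2.differentiable (by simp)⟩
  have df := fun m => (slice f hf m).1
  have df' := fun m => (slice f hf m).2
  have dg := fun m => (slice g hg m).1
  have dg' := fun m => (slice g hg m).2
  have zero_eq : ∀ δ, hirota2 0 δ f g n = fun y => f (n + δ) y * g (n - δ) y :=
    fun δ => funext fun y => hirota2_zero δ f g n y
  have one_eq : ∀ δ, hirota2 1 δ f g n = fun y =>
      deriv (f (n + δ)) y * g (n - δ) y - f (n + δ) y * deriv (g (n - δ)) y :=
    fun δ => funext fun y => hirota2_one (df _) (dg _) y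
  have zero_deriv : ∀ δ y, HasDerivAt (hirota2 0 δ f g n)
      (deriv (f (n + δ)) y * g (n - δ) y + f (n + δ) y * deriv (g (n - δ)) y) y := by
    intro δ y
    rw [zero_eq]
    exact (df _ y).hasDerivAt.mul (dg _ y).hasDerivAt
  have one_deriv : ∀ δ y, HasDerivAt (hirota2 1 δ f g n)
      (deriv (deriv (f (n + δ))) y * g (n - δ) y
        - f (n + δ) y * deriv (deriv (g (n - δ))) y) y := by
    intro δ y
    rw [one_eq]
    exact (((df' _ y).hasDerivAt.mul (dg _ y).hasDerivAt).sub
      ((df _ y).hasDerivAt.mul (dg' _ y).hasDerivAt)).congr_deriv (by ring)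
  have zero_diff : ∀ δ, Differentiable ℝ (hirota2 0 δ f g n) :=
    fun δ y => (zero_deriv δ y).differentiableAt
  have one_diff : ∀ δ, Differentiable ℝ (hirota2 1 δ f g n) :=
    fun δ y => (one_deriv δ y).differentiableAt
  rw [hirota2_two (df _) (df _) (df' _) (df' _), hirota2_two (dg _) (dg _) (dg' _) (dg' _),
    hirota2_one (A := hirota2 1 (h/2) f g) (B := hirota2 0 (-(h/2)) f g)
      (by simpa using one_diff _) (by simpa using zero_diff _),
    hirota2_one (A := hirota2 0 (h/2) f g) (B := hirota2 1 (-(h/2)) f g)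
      (by simpa using zero_diff _) (by simpa using one_diff _)]
  simp only [add_zero, sub_zero, (zero_deriv _ _).deriv, (one_deriv _ _).deriv]
  simp only [hirota2_zero, one_eq, sub_neg_eq_add, ← sub_eq_add_neg]
  ring
end

section
/- (Bilinear identity A.5.) For all smooth functions f, g : ℝ³ → ℝ of (n, x, y), every real h, and every point: D_y[(D_x e^{(h/2)D_n} f·g)·(e^{−(h/2)D_n} f·g)] + D_y[(e^{(h/2)D_n} f·g)·(D_x e^{−(h/2)D_n} f·g)] = 2·sinh((h/2)D_n)[(D_xD_y f·g)·(f g)] + 2·sinh((h/2)D_n)[(D_y f·g)·(D_x f·g)], where the sinh-shift operators on the right act on the indicated pairs of functions of (n, x, y). -/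
/-- Hirota bilinear operator `D_x^a D_y^b e^{δ D_n}` applied to a pair of functions
of `(n, x, y)`, evaluated at `(n, x, y)`. -/
noncomputable def hirota3xy (a b : ℕ) (δ : ℝ) (A B : ℝ → ℝ → ℝ → ℝ) (n x y : ℝ) : ℝ :=
  iteratedDeriv a (fun r =>
    iteratedDeriv b (fun s => A (n + δ) (x + r) (y + s) * B (n - δ) (x - r) (y - s)) 0) 0

theorem DifferentiableAt.hasDerivAt_slice_snd {E : Type*} [NormedAddCommGroup E] [NormedSpace ℝ E]
    {F : ℝ × ℝ × ℝ → E} {n x y : ℝ} (hF : DifferentiableAt ℝ F (n, x, y)) :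
    HasDerivAt (fun x => F (n, x, y)) (fderiv ℝ F (n, x, y) (0, 1, 0)) x :=
  hF.hasFDerivAt.comp_hasDerivAt (f := fun x : ℝ => (n, x, y)) x
    ((hasDerivAt_const x n).prodMk ((hasDerivAt_id x).prodMk (hasDerivAt_const x y)))

theorem DifferentiableAt.hasDerivAt_slice_trd {E : Type*} [NormedAddCommGroup E] [NormedSpace ℝ E]
    {F : ℝ × ℝ × ℝ → E} {n x y : ℝ} (hF : DifferentiableAt ℝ F (n, x, y)) :
    HasDerivAt (fun y => F (n, x, y)) (fderiv ℝ F (n, x, y) (0, 0, 1)) y :=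
  hF.hasFDerivAt.comp_hasDerivAt (f := fun y : ℝ => (n, x, y)) y
    ((hasDerivAt_const y n).prodMk ((hasDerivAt_const y x).prodMk (hasDerivAt_id y)))

theorem exists_mixed_partials (f : ℝ → ℝ → ℝ → ℝ)
    (hf : ContDiff ℝ (⊤ : ℕ∞) (fun pt : ℝ × ℝ × ℝ => f pt.1 pt.2.1 pt.2.2)) :
    ∃ fx fy fxy : ℝ → ℝ → ℝ → ℝ,
      (∀ n x y, HasDerivAt (fun x => f n x y) (fx n x y) x) ∧
      (∀ n x y, HasDerivAt (fun y => f n x y) (fy n x y) y) ∧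
      (∀ n x y, HasDerivAt (fun y => fx n x y) (fxy n x y) y) ∧
      (∀ n x y, HasDerivAt (fun x => fy n x y) (fxy n x y) x) := by
  set F : ℝ × ℝ × ℝ → ℝ := fun pt => f pt.1 pt.2.1 pt.2.2
  have hf₂ : ContDiff ℝ 2 F := contDiff_infty.1 hf 2
  have hF : Differentiable ℝ F := hf₂.differentiable (by simp)
  have hF' : Differentiable ℝ (fderiv ℝ F) :=
    (hf₂.fderiv_right (m := 1) (by norm_num)).differentiable (by simp)
  have symm : ∀ p v w, fderiv ℝ (fderiv ℝ F) p v w = fderiv ℝ (fderiv ℝ F) p w v :=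
    fun p v w => (hf₂.contDiffAt.isSymmSndFDerivAt (by simp)) v w
  refine ⟨fun n x y => fderiv ℝ F (n, x, y) (0, 1, 0), fun n x y => fderiv ℝ F (n, x, y) (0, 0, 1),
    fun n x y => fderiv ℝ (fderiv ℝ F) (n, x, y) (0, 0, 1) (0, 1, 0), ?_, ?_, ?_, ?_⟩
  · exact fun n x y => (hF (n, x, y)).hasDerivAt_slice_snd
  · exact fun n x y => (hF (n, x, y)).hasDerivAt_slice_trd
  · intro n x y
    simpa using (hF' (n, x, y)).hasDerivAt_slice_trd.clm_apply
      (hasDerivAt_const y ((0, 1, 0) : ℝ × ℝ × ℝ))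
  · intro n x y
    beta_reduce
    rw [symm]
    simpa using (hF' (n, x, y)).hasDerivAt_slice_snd.clm_apply
      (hasDerivAt_const x ((0, 0, 1) : ℝ × ℝ × ℝ))

theorem deriv_mul_add_sub {A B : ℝ → ℝ} {A' B' z : ℝ}
    (hA : HasDerivAt A A' z) (hB : HasDerivAt B B' z) :
    deriv (fun r => A (z + r) * B (z - r)) 0 = A' * B z - A z * B' := by
  have hA' : HasDerivAt (fun r => A (z + r)) A' 0 :=
    HasDerivAt.comp_const_add z 0 (by simpa using hA)
  have hB' : HasDerivAt (fun r => B (z - r)) (-B') 0 :=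
    HasDerivAt.comp_const_sub z 0 (by simpa using hB)
  rw [(hA'.fun_mul hB').deriv]
  simp
  ring

theorem hirota3xy_zero_zero (δ : ℝ) (A B : ℝ → ℝ → ℝ → ℝ) (n x y : ℝ) :
    hirota3xy 0 0 δ A B n x y = A (n + δ) x y * B (n - δ) x y := by
  simp [hirota3xy]

theorem hirota3xy_one_zero (δ : ℝ) {A B Ax Bx : ℝ → ℝ → ℝ → ℝ}
    (hA : ∀ n x y, HasDerivAt (fun x => A n x y) (Ax n x y) x)
    (hB : ∀ n x y, HasDerivAt (fun x => B n x y) (Bx n x y) x) (n x y : ℝ) :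
    hirota3xy 1 0 δ A B n x y
      = Ax (n + δ) x y * B (n - δ) x y - A (n + δ) x y * Bx (n - δ) x y := by
  simpa [hirota3xy] using deriv_mul_add_sub (hA (n + δ) x y) (hB (n - δ) x y)

theorem hirota3xy_zero_one (δ : ℝ) {A B Ay By : ℝ → ℝ → ℝ → ℝ}
    (hA : ∀ n x y, HasDerivAt (fun y => A n x y) (Ay n x y) y)
    (hB : ∀ n x y, HasDerivAt (fun y => B n x y) (By n x y) y) (n x y : ℝ) :
    hirota3xy 0 1 δ A B n x y
      = Ay (n + δ) x y * B (n - δ) x y - A (n + δ) x y * By (n - δ) x y := by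
  simpa [hirota3xy] using deriv_mul_add_sub (hA (n + δ) x y) (hB (n - δ) x y)

theorem hirota3xy_one_one (δ : ℝ) {A B Ax Bx Ay By Axy Bxy : ℝ → ℝ → ℝ → ℝ}
    (hAx : ∀ n x y, HasDerivAt (fun x => A n x y) (Ax n x y) x)
    (hBx : ∀ n x y, HasDerivAt (fun x => B n x y) (Bx n x y) x)
    (hAy : ∀ n x y, HasDerivAt (fun y => A n x y) (Ay n x y) y)
    (hBy : ∀ n x y, HasDerivAt (fun y => B n x y) (By n x y) y)
    (hAxy : ∀ n x y, HasDerivAt (fun x => Ay n x y) (Axy n x y) x)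
    (hBxy : ∀ n x y, HasDerivAt (fun x => By n x y) (Bxy n x y) x) (n x y : ℝ) :
    hirota3xy 1 1 δ A B n x y
      = Axy (n + δ) x y * B (n - δ) x y - Ay (n + δ) x y * Bx (n - δ) x y
        - Ax (n + δ) x y * By (n - δ) x y + A (n + δ) x y * Bxy (n - δ) x y := by
  have inner : ∀ r, deriv (fun s => A (n + δ) (x + r) (y + s) * B (n - δ) (x - r) (y - s)) 0
      = Ay (n + δ) (x + r) y * B (n - δ) (x - r) y
        - A (n + δ) (x + r) y * By (n - δ) (x - r) y :=
    fun r => deriv_mul_add_sub (hAy (n + δ) (x + r) y) (hBy (n - δ) (x - r) y)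
  have shift_add : ∀ {C Cx : ℝ → ℝ → ℝ → ℝ},
      (∀ n x y, HasDerivAt (fun x => C n x y) (Cx n x y) x) →
      DifferentiableAt ℝ (fun r => C (n + δ) (x + r) y) 0 := fun hC =>
    (HasDerivAt.comp_const_add x 0 (hC (n + δ) (x + 0) y)).differentiableAt
  have shift_sub : ∀ {C Cx : ℝ → ℝ → ℝ → ℝ},
      (∀ n x y, HasDerivAt (fun x => C n x y) (Cx n x y) x) →
      DifferentiableAt ℝ (fun r => C (n - δ) (x - r) y) 0 := fun hC =>
    (HasDerivAt.comp_const_sub x 0 (hC (n - δ) (x - 0) y)).differentiableAt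
  simp only [hirota3xy, iteratedDeriv_one, inner]
  rw [deriv_fun_sub ((shift_add hAxy).fun_mul (shift_sub hBx))
      ((shift_add hAx).fun_mul (shift_sub hBxy)),
    deriv_mul_add_sub (hAxy (n + δ) x y) (hBx (n - δ) x y),
    deriv_mul_add_sub (hAx (n + δ) x y) (hBxy (n - δ) x y)]
  ring

/-- Bilinear identity (A.5). -/
theorem bilinear_identity_A5
    (f g : ℝ → ℝ → ℝ → ℝ)
    (hf : ContDiff ℝ (⊤ : ℕ∞) (fun pt : ℝ × ℝ × ℝ => f pt.1 pt.2.1 pt.2.2))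
    (hg : ContDiff ℝ (⊤ : ℕ∞) (fun pt : ℝ × ℝ × ℝ => g pt.1 pt.2.1 pt.2.2))
    (h n x y : ℝ) :
    hirota3xy 0 1 0 (hirota3xy 1 0 (h/2) f g) (hirota3xy 0 0 (-(h/2)) f g) n x y
        + hirota3xy 0 1 0 (hirota3xy 0 0 (h/2) f g) (hirota3xy 1 0 (-(h/2)) f g) n x y
      = (hirota3xy 0 0 (h/2) (hirota3xy 1 1 0 f g)
            (fun n' x' y' => f n' x' y' * g n' x' y') n x y
          - hirota3xy 0 0 (-(h/2)) (hirota3xy 1 1 0 f g)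
            (fun n' x' y' => f n' x' y' * g n' x' y') n x y)
        + (hirota3xy 0 0 (h/2) (hirota3xy 0 1 0 f g) (hirota3xy 1 0 0 f g) n x y
          - hirota3xy 0 0 (-(h/2)) (hirota3xy 0 1 0 f g) (hirota3xy 1 0 0 f g) n x y) := by
  obtain ⟨fx, fy, fxy, hfx, hfy, hfxy, hfyx⟩ := exists_mixed_partials f hf
  obtain ⟨gx, gy, gxy, hgx, hgy, hgxy, hgyx⟩ := exists_mixed_partials g hg
  have shift_y : ∀ δ n x y, HasDerivAt (fun y => hirota3xy 0 0 δ f g n x y)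
      (fy (n + δ) x y * g (n - δ) x y + f (n + δ) x y * gy (n - δ) x y) y := by
    intro δ n x y
    simp only [hirota3xy_zero_zero]
    exact (hfy _ _ _).fun_mul (hgy _ _ _)
  have shift_xy : ∀ δ n x y, HasDerivAt (fun y => hirota3xy 1 0 δ f g n x y)
      ((fxy (n + δ) x y * g (n - δ) x y + fx (n + δ) x y * gy (n - δ) x y)
        - (fy (n + δ) x y * gx (n - δ) x y + f (n + δ) x y * gxy (n - δ) x y)) y := by
    intro δ n x y
    simp only [hirota3xy_one_zero δ hfx hgx]
    exact ((hfxy _ _ _).fun_mul (hgy _ _ _)).fun_sub ((hfy _ _ _).fun_mul (hgxy _ _ _))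
  rw [hirota3xy_zero_one 0 (shift_xy (h / 2)) (shift_y (-(h / 2))),
    hirota3xy_zero_one 0 (shift_y (h / 2)) (shift_xy (-(h / 2)))]
  simp only [hirota3xy_zero_zero, hirota3xy_one_zero _ hfx hgx, hirota3xy_zero_one _ hfy hgy,
    hirota3xy_one_one _ hfx hgx hfy hgy hfyx hgyx, add_zero, sub_zero, sub_neg_eq_add,
    ← sub_eq_add_neg]
  ring
end

section
/- (Bilinear identity A.8.) For all smooth functions f, g : ℝ³ → ℝ of (n, z, t), every real h, and every point: (D_zD_t e^{(h/2)D_n} f·f)(e^{(h/2)D_n} g·g) − (e^{(h/2)D_n} f·f)(D_zD_t e^{(h/2)D_n} g·g) = (1/2) D_z[(D_t e^{(h/2)D_n} f·g)·(e^{−(h/2)D_n} f·g)] − (1/2) D_z[(e^{(h/2)D_n} f·g)·(D_t e^{−(h/2)D_n} f·g)] + (1/2) D_t[(D_z e^{(h/2)D_n} f·g)·(e^{−(h/2)D_n} f·g)] − (1/2) D_t[(e^{(h/2)D_n} f·g)·(D_z e^{−(h/2)D_n} f·g)]. -/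
/-- Hirota bilinear operator `D_z^a D_t^b e^{δ D_n}` applied to a pair of functions
of `(n, z, t)`, evaluated at `(n, z, t)`. -/
noncomputable def hirota3zt (a b : ℕ) (δ : ℝ) (A B : ℝ → ℝ → ℝ → ℝ) (n z t : ℝ) : ℝ :=
  iteratedDeriv a (fun r =>
    iteratedDeriv b (fun s => A (n + δ) (z + r) (t + s) * B (n - δ) (z - r) (t - s)) 0) 0

/-- A smooth function of `(n, z, t)` has partial derivatives in `z` and `t`, and its mixed
partial derivatives coincide. -/
theorem exists_partial_derivs_zt (f : ℝ → ℝ → ℝ → ℝ)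
    (hf : ContDiff ℝ (⊤ : ℕ∞) (fun pt : ℝ × ℝ × ℝ => f pt.1 pt.2.1 pt.2.2)) :
    ∃ fz ft fzt : ℝ → ℝ → ℝ → ℝ,
      (∀ n z t, HasDerivAt (fun r => f n r t) (fz n z t) z) ∧
      (∀ n z t, HasDerivAt (fun s => f n z s) (ft n z t) t) ∧
      (∀ n z t, HasDerivAt (fun r => ft n r t) (fzt n z t) z) ∧
      (∀ n z t, HasDerivAt (fun s => fz n z s) (fzt n z t) t) := by
  set F : ℝ × ℝ × ℝ → ℝ := fun pt => f pt.1 pt.2.1 pt.2.2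
  have curve_z (n z t : ℝ) : HasDerivAt (fun r : ℝ => (n, r, t)) ((0, 1, 0) : ℝ × ℝ × ℝ) z :=
    (hasDerivAt_const z n).prodMk ((hasDerivAt_id z).prodMk (hasDerivAt_const z t))
  have curve_t (n z t : ℝ) : HasDerivAt (fun s : ℝ => (n, z, s)) ((0, 0, 1) : ℝ × ℝ × ℝ) t :=
    (hasDerivAt_const t n).prodMk ((hasDerivAt_const t z).prodMk (hasDerivAt_id t))
  have apply_deriv {G : ℝ × ℝ × ℝ → (ℝ × ℝ × ℝ →L[ℝ] ℝ)}
      {G' : ℝ × ℝ × ℝ →L[ℝ] ℝ × ℝ × ℝ →L[ℝ] ℝ} {p v w : ℝ × ℝ × ℝ} {c : ℝ → ℝ × ℝ × ℝ} {x : ℝ}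
      (hG : HasFDerivAt G G' p) (hc : HasDerivAt c v x) (hp : p = c x) :
      HasDerivAt (fun r => G (c r) w) (G' v w) x := by
    subst hp
    exact ((ContinuousLinearMap.apply ℝ ℝ w).hasFDerivAt.comp (c x) hG).comp_hasDerivAt x hc
  have hF1 (p) : HasFDerivAt F (fderiv ℝ F p) p :=
    (hf.differentiable (by simp) p).hasFDerivAt
  have hF2 (p) : HasFDerivAt (fderiv ℝ F) (fderiv ℝ (fderiv ℝ F) p) p :=
    ((hf.fderiv_right (m := 1) (by norm_cast)).differentiable (by simp) p).hasFDerivAt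
  refine ⟨fun n z t => fderiv ℝ F (n, z, t) (0, 1, 0), fun n z t => fderiv ℝ F (n, z, t) (0, 0, 1),
    fun n z t => fderiv ℝ (fderiv ℝ F) (n, z, t) (0, 1, 0) (0, 0, 1), fun n z t => ?_,
    fun n z t => ?_, fun n z t => ?_, fun n z t => ?_⟩
  · exact (hF1 (n, z, t)).comp_hasDerivAt z (curve_z n z t)
  · exact (hF1 (n, z, t)).comp_hasDerivAt t (curve_t n z t)
  · exact apply_deriv (hF2 (n, z, t)) (curve_z n z t) rfl
  · have hsymm : IsSymmSndFDerivAt ℝ F (n, z, t) :=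
      (contDiff_infty.1 hf 2).contDiffAt.isSymmSndFDerivAt (by simp)
    beta_reduce
    rw [hsymm (0, 1, 0) (0, 0, 1)]
    exact apply_deriv (hF2 (n, z, t)) (curve_t n z t) rfl

theorem hasDerivAt_mul_reflect_s17 {a b : ℝ → ℝ} {a' b' x : ℝ} (ha : HasDerivAt a a' x)
    (hb : HasDerivAt b b' x) :
    HasDerivAt (fun r => a (x + r) * b (x - r)) (a' * b x - a x * b') 0 := by
  have ha0 : HasDerivAt (fun r => a (x + r)) a' 0 :=
    HasDerivAt.comp_const_add x 0 (by simpa using ha)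
  have hb0 : HasDerivAt (fun r => b (x - r)) (-b') 0 :=
    HasDerivAt.comp_const_sub x 0 (by simpa using hb)
  have hab := ha0.fun_mul hb0
  rwa [add_zero, sub_zero, mul_neg, ← sub_eq_add_neg] at hab

theorem hirota3zt_zero_zero (δ : ℝ) (A B : ℝ → ℝ → ℝ → ℝ) (n z t : ℝ) :
    hirota3zt 0 0 δ A B n z t = A (n + δ) z t * B (n - δ) z t := by
  simp [hirota3zt]

theorem hirota3zt_one_zero {δ : ℝ} {A B : ℝ → ℝ → ℝ → ℝ} {n z t a b : ℝ}
    (hA : HasDerivAt (fun r => A (n + δ) r t) a z)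
    (hB : HasDerivAt (fun r => B (n - δ) r t) b z) :
    hirota3zt 1 0 δ A B n z t = a * B (n - δ) z t - A (n + δ) z t * b := by
  simpa [hirota3zt] using (hasDerivAt_mul_reflect_s17 hA hB).deriv

theorem hirota3zt_zero_one {δ : ℝ} {A B : ℝ → ℝ → ℝ → ℝ} {n z t a b : ℝ}
    (hA : HasDerivAt (fun s => A (n + δ) z s) a t)
    (hB : HasDerivAt (fun s => B (n - δ) z s) b t) :
    hirota3zt 0 1 δ A B n z t = a * B (n - δ) z t - A (n + δ) z t * b := by
  simpa [hirota3zt] using (hasDerivAt_mul_reflect_s17 hA hB).deriv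

theorem hirota3zt_one_one {A B Az Bz At Bt Azt Bzt : ℝ → ℝ → ℝ → ℝ}
    (hAz : ∀ n z t, HasDerivAt (fun r => A n r t) (Az n z t) z)
    (hAt : ∀ n z t, HasDerivAt (fun s => A n z s) (At n z t) t)
    (hAzt : ∀ n z t, HasDerivAt (fun r => At n r t) (Azt n z t) z)
    (hBz : ∀ n z t, HasDerivAt (fun r => B n r t) (Bz n z t) z)
    (hBt : ∀ n z t, HasDerivAt (fun s => B n z s) (Bt n z t) t)
    (hBzt : ∀ n z t, HasDerivAt (fun r => Bt n r t) (Bzt n z t) z) (δ n z t : ℝ) :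
    hirota3zt 1 1 δ A B n z t =
      Azt (n + δ) z t * B (n - δ) z t - At (n + δ) z t * Bz (n - δ) z t
        - (Az (n + δ) z t * Bt (n - δ) z t - A (n + δ) z t * Bzt (n - δ) z t) := by
  have inner (r : ℝ) :
      deriv (fun s => A (n + δ) (z + r) (t + s) * B (n - δ) (z - r) (t - s)) 0 =
        At (n + δ) (z + r) t * B (n - δ) (z - r) t
          - A (n + δ) (z + r) t * Bt (n - δ) (z - r) t :=
    (hasDerivAt_mul_reflect_s17 (hAt (n + δ) (z + r) t) (hBt (n - δ) (z - r) t)).deriv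
  simp only [hirota3zt, iteratedDeriv_one, inner]
  exact ((hasDerivAt_mul_reflect_s17 (hAzt (n + δ) z t) (hBz (n - δ) z t)).fun_sub
    (hasDerivAt_mul_reflect_s17 (hAz (n + δ) z t) (hBzt (n - δ) z t))).deriv

/-- Bilinear identity (A.8). -/
theorem bilinear_identity_A8
    (f g : ℝ → ℝ → ℝ → ℝ)
    (hf : ContDiff ℝ (⊤ : ℕ∞) (fun pt : ℝ × ℝ × ℝ => f pt.1 pt.2.1 pt.2.2))
    (hg : ContDiff ℝ (⊤ : ℕ∞) (fun pt : ℝ × ℝ × ℝ => g pt.1 pt.2.1 pt.2.2))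
    (h n z t : ℝ) :
    hirota3zt 1 1 (h/2) f f n z t * hirota3zt 0 0 (h/2) g g n z t
        - hirota3zt 0 0 (h/2) f f n z t * hirota3zt 1 1 (h/2) g g n z t
      = (1/2) * hirota3zt 1 0 0 (hirota3zt 0 1 (h/2) f g) (hirota3zt 0 0 (-(h/2)) f g) n z t
        - (1/2) * hirota3zt 1 0 0 (hirota3zt 0 0 (h/2) f g) (hirota3zt 0 1 (-(h/2)) f g) n z t
        + (1/2) * hirota3zt 0 1 0 (hirota3zt 1 0 (h/2) f g) (hirota3zt 0 0 (-(h/2)) f g) n z t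
        - (1/2) * hirota3zt 0 1 0 (hirota3zt 0 0 (h/2) f g) (hirota3zt 1 0 (-(h/2)) f g) n z t := by
  obtain ⟨fz, ft, fzt, hfz, hft, hftz, hfzt⟩ := exists_partial_derivs_zt f hf
  obtain ⟨gz, gt, gzt, hgz, hgt, hgtz, hgzt⟩ := exists_partial_derivs_zt g hg
  have h00 (δ : ℝ) : hirota3zt 0 0 δ f g = fun n z t => f (n + δ) z t * g (n - δ) z t := by
    funext n z t
    exact hirota3zt_zero_zero δ f g n z t
  have h10 (δ : ℝ) : hirota3zt 1 0 δ f g = fun n z t =>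
      fz (n + δ) z t * g (n - δ) z t - f (n + δ) z t * gz (n - δ) z t := by
    funext n z t
    exact hirota3zt_one_zero (hfz _ _ _) (hgz _ _ _)
  have h01 (δ : ℝ) : hirota3zt 0 1 δ f g = fun n z t =>
      ft (n + δ) z t * g (n - δ) z t - f (n + δ) z t * gt (n - δ) z t := by
    funext n z t
    exact hirota3zt_zero_one (hft _ _ _) (hgt _ _ _)
  have dz (p q t z : ℝ) := (hfz p z t).fun_mul (hgz q z t)
  have dt (p q t z : ℝ) := (hft p z t).fun_mul (hgt q z t)
  have dzt (p q t z : ℝ) :=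
    ((hftz p z t).fun_mul (hgz q z t)).fun_sub ((hfz p z t).fun_mul (hgtz q z t))
  have dtz (p q t z : ℝ) :=
    ((hfzt p z t).fun_mul (hgt q z t)).fun_sub ((hft p z t).fun_mul (hgzt q z t))
  rw [hirota3zt_one_one hfz hft hftz hfz hft hftz, hirota3zt_one_one hgz hgt hgtz hgz hgt hgtz,
    hirota3zt_zero_zero, hirota3zt_zero_zero, h00, h00, h10, h10, h01, h01,
    hirota3zt_one_zero (dzt _ _ _ _) (dz _ _ _ _), hirota3zt_one_zero (dz _ _ _ _) (dzt _ _ _ _),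
    hirota3zt_zero_one (dtz _ _ _ _) (dt _ _ _ _), hirota3zt_zero_one (dt _ _ _ _) (dtz _ _ _ _)]
  simp only [add_zero, sub_zero, sub_neg_eq_add, ← sub_eq_add_neg]
  ring
end

section
/- (Bilinear identity A.11.) For all smooth functions f, g : ℝ² → ℝ of (n, x), every real h, and every point (n, x): (D_x⁵ e^{(h/2)D_n} f·f)(e^{(h/2)D_n} g·g) − (e^{(h/2)D_n} f·f)(D_x⁵ e^{(h/2)D_n} g·g) = 2·sinh((h/2)D_n)[(D_x⁵ f·g)·(f g)] + 10·sinh((h/2)D_n)[(D_x³ f·g)·(D_x² f·g)] − 5 D_x[(D_x³ e^{(h/2)D_n} f·g)·(D_x e^{−(h/2)D_n} f·g)] − 5 D_x[(D_x e^{(h/2)D_n} f·g)·(D_x³ e^{−(h/2)D_n} f·g)] − 5[(D_x³ e^{(h/2)D_n} f·f)(D_x² e^{(h/2)D_n} g·g) − (D_x² e^{(h/2)D_n} f·f)(D_x³ e^{(h/2)D_n} g·g)]. -/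
/-- Leibniz expansion of the Hirota operator in terms of the `x`-derivatives. -/
theorem hirota2_eq_sum {A B : ℝ → ℝ → ℝ} {δ n : ℝ}
    (hA : ContDiff ℝ (⊤ : ℕ∞) (A (n + δ))) (hB : ContDiff ℝ (⊤ : ℕ∞) (B (n - δ)))
    (a : ℕ) (x : ℝ) :
    hirota2 a δ A B n x = ∑ k ∈ Finset.range (a + 1), (a.choose k : ℝ) * (-1) ^ (a - k) *
      (iteratedDeriv k (A (n + δ)) x * iteratedDeriv (a - k) (B (n - δ)) x) := by
  have hA' : ContDiffAt ℝ a (fun r => A (n + δ) (x + r)) 0 :=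
    ((hA.of_le (by exact_mod_cast le_top)).comp (contDiff_const.add contDiff_id)).contDiffAt
  have hB' : ContDiffAt ℝ a (fun r => B (n - δ) (x - r)) 0 :=
    ((hB.of_le (by exact_mod_cast le_top)).comp (contDiff_const.sub contDiff_id)).contDiffAt
  rw [hirota2, iteratedDeriv_fun_mul hA' hB']
  refine Finset.sum_congr rfl fun k _ => ?_
  simp only [iteratedDeriv_comp_const_add, iteratedDeriv_comp_const_sub, add_zero, sub_zero,
    smul_eq_mul]
  ring

theorem ContDiff.hasDerivAt_iteratedDeriv {u : ℝ → ℝ} (hu : ContDiff ℝ (⊤ : ℕ∞) u)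
    (k : ℕ) (x : ℝ) : HasDerivAt (iteratedDeriv k u) (iteratedDeriv (k + 1) u x) x := by
  rw [iteratedDeriv_succ]
  exact (hu.differentiable_iteratedDeriv k (by exact_mod_cast WithTop.coe_lt_top k) x).hasDerivAt

/-- The `x`-derivative of a Hirota expression. -/
theorem hasDerivAt_hirota2 {A B : ℝ → ℝ → ℝ} {δ n : ℝ}
    (hA : ContDiff ℝ (⊤ : ℕ∞) (A (n + δ))) (hB : ContDiff ℝ (⊤ : ℕ∞) (B (n - δ)))
    (a : ℕ) (x : ℝ) :
    HasDerivAt (hirota2 a δ A B n)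
      (∑ k ∈ Finset.range (a + 1), (a.choose k : ℝ) * (-1) ^ (a - k) *
        (iteratedDeriv (k + 1) (A (n + δ)) x * iteratedDeriv (a - k) (B (n - δ)) x +
          iteratedDeriv k (A (n + δ)) x * iteratedDeriv (a - k + 1) (B (n - δ)) x)) x := by
  rw [funext (hirota2_eq_sum hA hB a)]
  exact HasDerivAt.fun_sum fun k _ =>
    ((hA.hasDerivAt_iteratedDeriv k x).mul (hB.hasDerivAt_iteratedDeriv (a - k) x)).const_mul _

theorem hirota2_one_zero {A B : ℝ → ℝ → ℝ} {n x A' B' : ℝ}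
    (hA : HasDerivAt (A n) A' x) (hB : HasDerivAt (B n) B' x) :
    hirota2 1 0 A B n x = A' * B n x - A n x * B' := by
  have hA₀ : HasDerivAt (fun r => A n (x + r)) A' 0 :=
    HasDerivAt.comp_const_add x 0 (by simpa using hA)
  have hB₀ : HasDerivAt (fun r => B n (x - r)) (-B') 0 :=
    HasDerivAt.comp_const_sub x 0 (by simpa using hB)
  simp only [hirota2, iteratedDeriv_one, add_zero, sub_zero]
  rw [(hA₀.fun_mul hB₀).deriv]
  simp only [add_zero, sub_zero]
  ring

/-- Bilinear identity (A.11). -/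
theorem bilinear_identity_A11
    (f g : ℝ → ℝ → ℝ)
    (hf : ContDiff ℝ (⊤ : ℕ∞) (fun pt : ℝ × ℝ => f pt.1 pt.2))
    (hg : ContDiff ℝ (⊤ : ℕ∞) (fun pt : ℝ × ℝ => g pt.1 pt.2))
    (h n x : ℝ) :
    hirota2 5 (h/2) f f n x * hirota2 0 (h/2) g g n x
        - hirota2 0 (h/2) f f n x * hirota2 5 (h/2) g g n x
      = (hirota2 0 (h/2) (hirota2 5 0 f g) (fun n' x' => f n' x' * g n' x') n x
          - hirota2 0 (-(h/2)) (hirota2 5 0 f g) (fun n' x' => f n' x' * g n' x') n x)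
        + 5 * (hirota2 0 (h/2) (hirota2 3 0 f g) (hirota2 2 0 f g) n x
          - hirota2 0 (-(h/2)) (hirota2 3 0 f g) (hirota2 2 0 f g) n x)
        - 5 * hirota2 1 0 (hirota2 3 (h/2) f g) (hirota2 1 (-(h/2)) f g) n x
        - 5 * hirota2 1 0 (hirota2 1 (h/2) f g) (hirota2 3 (-(h/2)) f g) n x
        - 5 * (hirota2 3 (h/2) f f n x * hirota2 2 (h/2) g g n x
          - hirota2 2 (h/2) f f n x * hirota2 3 (h/2) g g n x) := by
  have hF (m : ℝ) : ContDiff ℝ (⊤ : ℕ∞) (f m) := hf.comp (contDiff_const.prodMk contDiff_id)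
  have hG (m : ℝ) : ContDiff ℝ (⊤ : ℕ∞) (g m) := hg.comp (contDiff_const.prodMk contDiff_id)
  rw [hirota2_one_zero (hasDerivAt_hirota2 (hF _) (hG _) 3 x)
      (hasDerivAt_hirota2 (hF _) (hG _) 1 x),
    hirota2_one_zero (hasDerivAt_hirota2 (hF _) (hG _) 1 x)
      (hasDerivAt_hirota2 (hF _) (hG _) 3 x)]
  simp only [hirota2_zero]
  simp only [hirota2_eq_sum (hF _) (hF _), hirota2_eq_sum (hG _) (hG _),
    hirota2_eq_sum (hF _) (hG _), Finset.sum_range_succ, Finset.sum_range_zero,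
    add_zero, sub_zero, sub_neg_eq_add, ← sub_eq_add_neg]
  norm_num [Nat.choose]
  ring
end
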